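/- arXiv:2511.10444 — 3 statements merged into one kernel-verified Lean document; each statement's English description precedes it below -/
import Mathlib

section
/- Let H be a complex Hilbert space and let P, Q be orthogonal projections on H (bounded operators with P = P* = P² and Q = Q* = Q²) such that ‖P − Q‖ < 1. Then the operator Id − (P − Q)² is a positive invertible operator, and the operator U = [QP + (Id − Q)(Id − P)] · (Id − (P − Q)²)^{−1/2} (where the inverse square root is taken via continuous functional calculus) is unitary and satisfies Q = U P U⁻¹. -/
noncomputable section

/-- The intertwiner of two idempotents `P`, `Q` and its reverse compose to `1 - (P - Q) ^ 2`. -/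
lemma IsIdempotentElem.intertwiner_mul_intertwiner {R : Type*} [Ring R] {P Q : R}
    (hP : IsIdempotentElem P) (hQ : IsIdempotentElem Q) :
    (P * Q + (1 - P) * (1 - Q)) * (Q * P + (1 - Q) * (1 - P)) = 1 - (P - Q) ^ 2 := by
  have hQ' (x : R) : Q * (Q * x) = Q * x := by rw [← mul_assoc, hQ.eq]
  simp only [pow_two, mul_sub, sub_mul, mul_add, add_mul, mul_assoc, hP.eq, hQ.eq, hQ',
    one_mul, mul_one]
  abel

lemma IsIdempotentElem.commute_one_sub_sub_sq {R : Type*} [Ring R] {P Q : R}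
    (hP : IsIdempotentElem P) (hQ : IsIdempotentElem Q) :
    Commute (1 - (P - Q) ^ 2) P := by
  have hP' (x : R) : P * (P * x) = P * x := by rw [← mul_assoc, hP.eq]
  simp only [commute_iff_eq, pow_two, mul_sub, sub_mul, mul_assoc, hP.eq, hQ.eq, hP',
    one_mul, mul_one]
  abel

lemma IsIdempotentElem.intertwiner_mul {R : Type*} [Ring R] {P Q : R}
    (hP : IsIdempotentElem P) (hQ : IsIdempotentElem Q) :
    (Q * P + (1 - Q) * (1 - P)) * P = Q * (Q * P + (1 - Q) * (1 - P)) := by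
  have hQ' (x : R) : Q * (Q * x) = Q * x := by rw [← mul_assoc, hQ.eq]
  simp only [mul_sub, sub_mul, mul_add, add_mul, mul_assoc, hP.eq, hQ.eq, hQ',
    one_mul, mul_one]
  abel

theorem kato_nagy {H : Type*} [NormedAddCommGroup H] [InnerProductSpace ℂ H] [CompleteSpace H]
    (P Q : H →L[ℂ] H)
    (hP : IsSelfAdjoint P) (hP2 : IsIdempotentElem P)
    (hQ : IsSelfAdjoint Q) (hQ2 : IsIdempotentElem Q)
    (hnorm : ‖P - Q‖ < 1) :
    (1 - (P - Q) ^ 2).IsPositive ∧ IsUnit (1 - (P - Q) ^ 2) ∧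
    (Q * P + (1 - Q) * (1 - P)) * cfc (fun x : ℝ => (Real.sqrt x)⁻¹) (1 - (P - Q) ^ 2)
      ∈ unitary (H →L[ℂ] H) ∧
    Q = ((Q * P + (1 - Q) * (1 - P)) * cfc (fun x : ℝ => (Real.sqrt x)⁻¹) (1 - (P - Q) ^ 2)) * P *
      star ((Q * P + (1 - Q) * (1 - P)) * cfc (fun x : ℝ => (Real.sqrt x)⁻¹) (1 - (P - Q) ^ 2)) := by
  set A : H →L[ℂ] H := 1 - (P - Q) ^ 2 with hA
  set V : H →L[ℂ] H := Q * P + (1 - Q) * (1 - P) with hV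
  set S : H →L[ℂ] H := cfc (fun x : ℝ => (Real.sqrt x)⁻¹) A with hS
  have hnorm_sq : ‖(P - Q) ^ 2‖ < 1 :=
    (norm_pow_le' _ two_pos).trans_lt (pow_lt_one₀ (norm_nonneg _) hnorm two_ne_zero)
  have hsa : IsSelfAdjoint ((P - Q) ^ 2) := (hP.sub hQ).pow 2
  have hnonneg : 0 ≤ A := by
    have hle := hsa.le_algebraMap_norm_self
    have hle' : algebraMap ℝ (H →L[ℂ] H) ‖(P - Q) ^ 2‖ ≤ algebraMap ℝ (H →L[ℂ] H) 1 :=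
      algebraMap_mono _ hnorm_sq.le
    rw [map_one] at hle'
    exact sub_nonneg.mpr (hle.trans hle')
  have hunit : IsUnit A := isUnit_one_sub_of_norm_lt_one hnorm_sq
  have hspec : ∀ x ∈ spectrum ℝ A, 0 < x := fun x hx =>
    (spectrum_nonneg_of_nonneg hnonneg hx).lt_of_ne
      (fun h => spectrum.zero_notMem ℝ hunit (h ▸ hx))
  have hS_star : star S = S := (cfc_predicate (p := IsSelfAdjoint) _ A).star_eq
  have hcont : ContinuousOn (fun x : ℝ => (Real.sqrt x)⁻¹) (spectrum ℝ A) :=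
    Real.continuous_sqrt.continuousOn.inv₀ fun x hx => (Real.sqrt_pos.mpr (hspec x hx)).ne'
  have hSSA : S * S * A = 1 := by
    rw [hS, ← cfc_mul _ _ A hcont hcont]
    nth_rewrite 2 [← cfc_id ℝ A]
    rw [← cfc_mul (fun x : ℝ => (Real.sqrt x)⁻¹ * (Real.sqrt x)⁻¹) id A (hcont.mul hcont)
      continuousOn_id, ← cfc_one ℝ A]
    refine cfc_congr fun x hx => ?_
    have hx0 := hspec x hx
    simp only [id, Pi.one_apply]
    rw [← mul_inv, Real.mul_self_sqrt hx0.le, inv_mul_cancel₀ hx0.ne']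
  have hAP : Commute A P := hP2.commute_one_sub_sub_sq hQ2
  have hAQ : Commute A Q := by
    have h := hQ2.commute_one_sub_sub_sq hP2
    rwa [← neg_sub P Q, neg_sq] at h
  have hSP : Commute S P := hAP.cfc_real _
  have hSQ : Commute S Q := hAQ.cfc_real _
  have hSA : Commute S A := (Commute.refl A).cfc_real _
  have hSV : Commute S V := (hSQ.mul_right hSP).add_right
    (((Commute.one_right S).sub_right hSQ).mul_right ((Commute.one_right S).sub_right hSP))
  have hV_star : star V = P * Q + (1 - P) * (1 - Q) := by
    simp [hV, hP.star_eq, hQ.star_eq]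
  have hVV : star V * V = A := by
    rw [hV_star]
    exact hP2.intertwiner_mul_intertwiner hQ2
  have hVV' : V * star V = A := by
    rw [hV_star, hA, ← neg_sub Q P, neg_sq]
    exact hQ2.intertwiner_mul_intertwiner hP2
  have hVP : V * P = Q * V := hP2.intertwiner_mul hQ2
  have hUU : V * S * star (V * S) = 1 := by
    rw [star_mul, hS_star, ← hSV.eq, ← hSSA, ← hVV']
    simp only [mul_assoc]
    rw [← mul_assoc V S, ← hSV.eq, mul_assoc]
  refine ⟨(ContinuousLinearMap.nonneg_iff_isPositive A).mp hnonneg, hunit,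
    Unitary.mem_iff.mpr ⟨?_, hUU⟩, ?_⟩
  · rw [star_mul, hS_star, mul_assoc, ← mul_assoc (star V), hVV, ← hSA.eq, ← mul_assoc, hSSA]
  · rw [mul_assoc V S P, hSP.eq, ← mul_assoc, hVP, mul_assoc Q, mul_assoc Q, hUU, mul_one]


end
end

section
/- Let P : ℝ → B(H) be a continuous map, 2π-periodic, such that each P(k) is an orthogonal projection of constant finite rank m on a complex separable Hilbert space H. Then there exists a continuous 2π-periodic map U : ℝ → U(H) with values in the unitary operators on H such that P(k) = U(k) P(0) U(k)⁻¹ for all k. Moreover, if T : H → H is an antiunitary operator with T² = −Id satisfying T∘P(k) = P(−k)∘T for all k, then U can be chosen so that additionally T∘U(k) = U(−k)∘T for all k. -/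
open scoped Real
open Complex

noncomputable section

section Intertwiner

variable {A : Type*} [CStarAlgebra A]

/-- The elementary (non-unitary) intertwiner from the projection `p` to the projection `q`. -/
def projIntertwiner (q p : A) : A := q * p + (1 - q) * (1 - p)

lemma projIntertwiner_mul {q p : A} (hp : IsIdempotentElem p) (hq : IsIdempotentElem q) :
    projIntertwiner q p * p = q * projIntertwiner q p := by
  have hp : p * p = p := hp
  have hq : q * q = q := hq
  have h1 : projIntertwiner q p * p = q * p := by
    simp only [projIntertwiner, add_mul, mul_assoc, sub_mul, one_mul, hp]
    simp
  have h2 : q * projIntertwiner q p = q * p := by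
    simp only [projIntertwiner, mul_add, ← mul_assoc, mul_sub, mul_one, hq]
    simp
  rw [h1, h2]

lemma projIntertwiner_mul_swap {q p : A} (hp : IsIdempotentElem p) (hq : IsIdempotentElem q) :
    projIntertwiner q p * projIntertwiner p q = 1 - (p - q) * (p - q) := by
  have hp : p * p = p := hp
  have hq : q * q = q := hq
  have hpx : ∀ x, p * (p * x) = p * x := fun x => by rw [← mul_assoc, hp]
  simp only [projIntertwiner, mul_add, add_mul, mul_sub, sub_mul, mul_one, one_mul, mul_assoc,
    hp, hq, hpx]
  abel

lemma isUnit_projIntertwiner {q p : A} (hp : IsIdempotentElem p) (hq : IsIdempotentElem q)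
    (h : ‖q - p‖ < 1) : IsUnit (projIntertwiner q p) := by
  have key : ∀ {a b : A}, ‖a - b‖ < 1 → IsUnit (1 - (a - b) * (a - b)) := fun {a b} hab =>
    isUnit_one_sub_of_norm_lt_one <| (norm_mul_le _ _).trans_lt <| by
      nlinarith [norm_nonneg (a - b)]
  have h1 := key (norm_sub_rev p q ▸ h)
  have h2 : projIntertwiner p q * projIntertwiner q p = 1 - (p - q) * (p - q) := by
    rw [projIntertwiner_mul_swap hq hp, ← neg_sub p q, neg_mul_neg]
  have hc : Commute (projIntertwiner q p) (projIntertwiner p q) := by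
    rw [Commute, SemiconjBy, projIntertwiner_mul_swap hp hq, h2]
  rw [← projIntertwiner_mul_swap hp hq] at h1
  exact (hc.isUnit_mul_iff.mp h1).1

/-- The product of the elementary intertwiners along `P 0, P h, …, P (n * h)`. -/
def stepIntertwiner (P : ℝ → A) (h : ℝ) : ℕ → A
  | 0 => 1
  | n + 1 => projIntertwiner (P ((n + 1 : ℕ) * h)) (P (n * h)) * stepIntertwiner P h n

lemma stepIntertwiner_mul {P : ℝ → A} (hP : ∀ k, IsIdempotentElem (P k)) (h : ℝ) (n : ℕ) :
    stepIntertwiner P h n * P 0 = P (n * h) * stepIntertwiner P h n := by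
  induction n with
  | zero => simp [stepIntertwiner]
  | succ n ih =>
    rw [stepIntertwiner, mul_assoc, ih, ← mul_assoc, projIntertwiner_mul (hP _) (hP _), mul_assoc]

lemma isUnit_stepIntertwiner {P : ℝ → A} (hP : ∀ k, IsIdempotentElem (P k)) (h : ℝ) (n : ℕ)
    (hn : ∀ j : ℕ, j < n → ‖P ((j + 1 : ℕ) * h) - P (j * h)‖ < 1) :
    IsUnit (stepIntertwiner P h n) := by
  induction n with
  | zero => exact isUnit_one
  | succ n ih =>
    exact (isUnit_projIntertwiner (hP _) (hP _) (hn n n.lt_succ_self)).mul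
      (ih fun j hj => hn j (hj.trans n.lt_succ_self))

lemma continuous_stepIntertwiner {P : ℝ → A} (hP : Continuous P) (n : ℕ) :
    Continuous fun h => stepIntertwiner P h n := by
  induction n with
  | zero => exact continuous_const
  | succ n ih =>
    simp only [stepIntertwiner, projIntertwiner]
    fun_prop

lemma map_stepIntertwiner {P : ℝ → A} (φ : A →⋆ₐ[ℝ] A) (hφ : ∀ k, φ (P k) = P (-k)) (h : ℝ)
    (n : ℕ) : φ (stepIntertwiner P h n) = stepIntertwiner P (-h) n := by
  induction n with
  | zero => exact map_one φ
  | succ n ih => simp [stepIntertwiner, projIntertwiner, ih, hφ]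

section Polar

variable [PartialOrder A] [StarOrderedRing A]

/-- The unitary part of the polar decomposition (of an invertible element). -/
def polarPart (a : A) : A := a * Ring.inverse (CFC.abs a)

lemma isUnit_abs {a : A} (ha : IsUnit a) : IsUnit (CFC.abs a) := by
  rw [CFC.abs, CFC.isUnit_sqrt_iff _ (star_mul_self_nonneg a)]
  exact ha.star.mul ha

lemma polarPart_mem_unitary {a : A} (ha : IsUnit a) : polarPart a ∈ unitary A := by
  have hu : IsUnit (polarPart a) := ha.mul (isUnit_abs ha).ringInverse
  have h1 : star (polarPart a) * polarPart a = 1 := by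
    have hs : star (Ring.inverse (CFC.abs a)) = Ring.inverse (CFC.abs a) := by
      rw [← Ring.inverse_star, (CFC.abs_nonneg a).isSelfAdjoint.star_eq]
    calc star (polarPart a) * polarPart a
        = Ring.inverse (CFC.abs a) * (star a * a) * Ring.inverse (CFC.abs a) := by
          simp only [polarPart, star_mul, hs, mul_assoc]
      _ = (Ring.inverse (CFC.abs a) * CFC.abs a) * (CFC.abs a * Ring.inverse (CFC.abs a)) := by
          simp only [← CFC.abs_mul_abs, mul_assoc]
      _ = 1 := by
          rw [Ring.inverse_mul_cancel _ (isUnit_abs ha), Ring.mul_inverse_cancel _ (isUnit_abs ha),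
            one_mul]
  exact ⟨h1, by rw [← hu.mul_left_inj, mul_assoc, h1, mul_one, one_mul]⟩

lemma polarPart_intertwines {a p q : A} (ha : IsUnit a) (hp : IsSelfAdjoint p)
    (hq : IsSelfAdjoint q) (h : a * p = q * a) : polarPart a * p = q * polarPart a := by
  have h' : p * star a = star a * q := by simpa [hp.star_eq, hq.star_eq] using congr(star $h)
  have hc : Commute (star a * a) p := by
    rw [Commute, SemiconjBy, mul_assoc, h, ← mul_assoc, ← h', mul_assoc]
  have hc' : Commute (CFC.abs a) p := Commute.cfcₙ_nnreal hc _
  have hi : Commute (Ring.inverse (CFC.abs a)) p := by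
    obtain ⟨u, hu⟩ := isUnit_abs ha
    rw [← hu] at hc' ⊢
    rw [Ring.inverse_unit]
    exact hc'.units_inv_left
  rw [polarPart, mul_assoc, hi.eq, ← mul_assoc, h, mul_assoc]

lemma continuousAt_polarPart {a : A} (ha : IsUnit a) : ContinuousAt polarPart a := by
  obtain ⟨u, hu⟩ := isUnit_abs ha
  refine continuousAt_id.mul (ContinuousAt.comp (g := Ring.inverse) ?_
    CFC.continuous_abs.continuousAt)
  rw [← hu]
  exact NormedRing.inverse_continuousAt u

lemma map_polarPart (φ : A →⋆ₐ[ℝ] A) {a : A} (ha : IsUnit a) :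
    φ (polarPart a) = polarPart (φ a) := by
  have hnn : 0 ≤ φ (CFC.abs a) := by
    have h := CFC.sqrt_mul_sqrt_self (CFC.abs a) (CFC.abs_nonneg a)
    rw [← h, map_mul]
    nth_rewrite 1 [← (CFC.sqrt_nonneg (CFC.abs a)).isSelfAdjoint.star_eq]
    rw [map_star]
    exact star_mul_self_nonneg _
  have habs : φ (CFC.abs a) = CFC.abs (φ a) := by
    refine (CFC.sqrt_unique ?_ hnn).symm
    rw [← map_mul, CFC.abs_mul_abs, map_mul, map_star]
  rw [polarPart, polarPart, map_mul, ← habs]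
  congr 1
  have hu := isUnit_abs ha
  rw [← (hu.map φ).mul_left_inj, ← map_mul, Ring.inverse_mul_cancel _ hu, map_one,
    Ring.inverse_mul_cancel _ (hu.map φ)]

end Polar

end Intertwiner

section OneParameterGroup

open scoped ComplexStarModule

variable {A : Type*} [CStarAlgebra A]

/-- `f` is the orthogonal projection onto the kernel of `n`, in algebraic terms. -/
structure IsKernelProjection (n f : A) : Prop where
  isSelfAdjoint : IsSelfAdjoint f
  mul_eq_zero : n * f = 0
  mul_eq_self : ∀ y, n * y = 0 → f * y = y

namespace IsKernelProjection

variable {n f : A}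

lemma mul_self (hf : IsKernelProjection n f) : f * f = f := hf.mul_eq_self f hf.mul_eq_zero

lemma commute (hf : IsKernelProjection n f) {q : A} (hq : IsSelfAdjoint q) (h : Commute n q) :
    Commute f q := by
  have h1 : f * (q * f) = q * f := hf.mul_eq_self _ <| by
    rw [← mul_assoc, h.eq, mul_assoc, hf.mul_eq_zero, mul_zero]
  have h2 : f * q * f = f * q := by
    simpa [hf.isSelfAdjoint.star_eq, hq.star_eq] using congr(star $h1)
  rw [Commute, SemiconjBy, ← h2, mul_assoc, h1]

lemma map_eq (hf : IsKernelProjection n f) {φ : A →⋆ₐ[ℝ] A} (hφ : ∀ a, φ (φ a) = a)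
    (h : φ n = n) : φ f = f := by
  have h1 : f * φ f = φ f := hf.mul_eq_self _ <| by
    nth_rewrite 1 [← h]
    rw [← map_mul, hf.mul_eq_zero, map_zero]
  have h2 : φ f * f = f := by simpa [hφ] using congr(φ $h1)
  have h3 : f * φ f = f := by
    simpa [hf.isSelfAdjoint.star_eq, ← map_star] using congr(star $h2)
  rw [← h1, h3]

end IsKernelProjection

/-- If `r` and `b` are commuting self-adjoint elements with the same square, then the reflection
in the kernel of `r - b` turns `r` into `b`. -/
lemma IsKernelProjection.reflection_mul {r b f : A} (hr : IsSelfAdjoint r) (hb : IsSelfAdjoint b)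
    (hf : IsKernelProjection (r - b) f) (hrb : Commute r b) (hsq : r * r = b * b) :
    (2 * f - 1) * r = b := by
  have h1 : f * r = f * b := by
    have := congr(star $(hf.mul_eq_zero))
    rw [star_mul, (hr.sub hb).star_eq, hf.isSelfAdjoint.star_eq, star_zero, mul_sub] at this
    exact sub_eq_zero.mp this
  have h2 : f * (r + b) = r + b := hf.mul_eq_self _ <| by
    rw [sub_mul, mul_add, mul_add, hsq, hrb.eq]
    abel
  rw [mul_add, ← h1] at h2
  rw [sub_mul, one_mul, mul_assoc, two_mul, h2, add_sub_cancel_left]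

lemma abs_le_one_of_mem_spectrum {a : A} (ha : ‖a‖ ≤ 1) {x : ℝ} (hx : x ∈ spectrum ℝ a) :
    |x| ≤ 1 := by
  rcases subsingleton_or_nontrivial A with _ | _
  · simp [spectrum.of_subsingleton] at hx
  · simpa using (spectrum.norm_le_norm_of_mem hx).trans ha

lemma continuous_cfc_comp_mul {g : ℝ → ℝ} (hg : Continuous g) {f : ℝ → ℝ} (hf : Continuous f)
    (a : A) : Continuous fun t : ℝ => cfc (fun x => g (t * f x)) a := by
  rw [continuous_iff_continuousAt]
  intro t
  refine continuousAt_cfc_fun ?_ (.of_forall fun s => by fun_prop)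
  rw [tendstoUniformlyOn_iff_tendstoUniformly_comp_coe]
  have : CompactSpace (spectrum ℝ a) := isCompact_iff_compactSpace.mp (spectrum.isCompact a)
  exact Continuous.tendstoUniformly (fun (t : ℝ) (x : spectrum ℝ a) => g (t * f x))
    (by simp only [Function.HasUncurry.uncurry]; fun_prop) t

lemma cfc_cos_add {f : ℝ → ℝ} (hf : Continuous f) (a : A) (s t : ℝ) :
    cfc (fun x => Real.cos ((s + t) * f x)) a =
      cfc (fun x => Real.cos (s * f x)) a * cfc (fun x => Real.cos (t * f x)) a -
        cfc (fun x => Real.sin (s * f x)) a * cfc (fun x => Real.sin (t * f x)) a := by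
  have hc : ∀ t, Continuous fun x => Real.cos (t * f x) := fun t => by fun_prop
  have hs : ∀ t, Continuous fun x => Real.sin (t * f x) := fun t => by fun_prop
  simp_rw [add_mul, Real.cos_add]
  rw [cfc_sub (fun x => Real.cos (s * f x) * Real.cos (t * f x))
      (fun x => Real.sin (s * f x) * Real.sin (t * f x)) a (by fun_prop) (by fun_prop),
    cfc_mul _ _ a (hc s).continuousOn (hc t).continuousOn,
    cfc_mul _ _ a (hs s).continuousOn (hs t).continuousOn]

lemma cfc_sin_add {f : ℝ → ℝ} (hf : Continuous f) (a : A) (s t : ℝ) :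
    cfc (fun x => Real.sin ((s + t) * f x)) a =
      cfc (fun x => Real.sin (s * f x)) a * cfc (fun x => Real.cos (t * f x)) a +
        cfc (fun x => Real.cos (s * f x)) a * cfc (fun x => Real.sin (t * f x)) a := by
  have hc : ∀ t, Continuous fun x => Real.cos (t * f x) := fun t => by fun_prop
  have hs : ∀ t, Continuous fun x => Real.sin (t * f x) := fun t => by fun_prop
  simp_rw [add_mul, Real.sin_add]
  rw [cfc_add a (fun x => Real.sin (s * f x) * Real.cos (t * f x))
      (fun x => Real.cos (s * f x) * Real.sin (t * f x)) (by fun_prop) (by fun_prop),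
    cfc_mul _ _ a (hs s).continuousOn (hc t).continuousOn,
    cfc_mul _ _ a (hc s).continuousOn (hs t).continuousOn]

lemma map_cfc_of_map_eq {φ : A →⋆ₐ[ℝ] A} (hφ : Continuous φ) {a : A} (ha : IsSelfAdjoint a)
    (h : φ a = a) {f : ℝ → ℝ} (hf : Continuous f) : φ (cfc f a) = cfc f a := by
  have := StarAlgHomClass.map_cfc (S := ℝ) φ f a hf.continuousOn hφ ha (h.symm ▸ ha)
  rwa [h] at this

lemma norm_le_one_of_mem_unitary {m : A} (hm : m ∈ unitary A) : ‖m‖ ≤ 1 := by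
  rcases subsingleton_or_nontrivial A with _ | _
  · simp [Subsingleton.elim m 0]
  · exact (CStarRing.norm_of_mem_unitary hm).le

/-- A unitary `m` lies on a one-parameter group of unitaries which inherits the symmetries
of `m`. The branch of the logarithm is chosen through the sign of `Im m`, i.e. through a
kernel projection, which is where the von Neumann algebra structure enters. -/
theorem exists_unitary_one_parameter_group
    (hker : ∀ n : A, ∃ f, IsKernelProjection n f) {m : A} (hm : m ∈ unitary A) :
    ∃ V : ℝ → A, Continuous V ∧ V 0 = 1 ∧ (∀ s t, V (s + t) = V s * V t) ∧ V 1 = m ∧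
      (∀ t, star (V t) = V (-t)) ∧
      (∀ q, IsSelfAdjoint q → Commute m q → ∀ t, Commute (V t) q) ∧
      ∀ φ : A →⋆ₐ[ℝ] A, Continuous φ → (∀ a, φ (φ a) = a) → (∀ a, φ (I • a) = -(I • φ a)) →
        φ m = star m → ∀ t, φ (V t) = V (-t) := by
  have hmn : IsStarNormal m := isStarNormal_of_mem_unitary hm
  set a : A := (ℜ m : A) with ha_def
  set b : A := (ℑ m : A) with hb_def
  have ha : IsSelfAdjoint a := (ℜ m).2
  have hb : IsSelfAdjoint b := (ℑ m).2
  have hab : a + I • b = m := realPart_add_I_smul_imaginaryPart m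
  have hac : Commute a b := .realPart_imaginaryPart m
  have hsq : a * a + b * b = 1 := by
    rw [ha_def, hb_def, ← star_mul_self_eq_realPart_sq_add_imaginaryPart_sq, hm.1]
  have hspec : ∀ x ∈ spectrum ℝ a, |x| ≤ 1 := fun x hx =>
    abs_le_one_of_mem_spectrum
      ((realPart.norm_le m).trans (norm_le_one_of_mem_unitary hm)) hx
  let C : ℝ → A := fun t => cfc (fun x => Real.cos (t * Real.arccos x)) a
  let S : ℝ → A := fun t => cfc (fun x => Real.sin (t * Real.arccos x)) a
  have hC0 : C 0 = 1 := by simp [C, cfc_const_one ℝ a]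
  have hS0 : S 0 = 0 := by simp [S, cfc_const_zero ℝ a]
  have hCneg : ∀ t, C (-t) = C t := fun t => by simp [C]
  have hSneg : ∀ t, S (-t) = -S t := fun t => by simp [S, cfc_neg]
  have hCadd : ∀ s t, C (s + t) = C s * C t - S s * S t := cfc_cos_add Real.continuous_arccos a
  have hSadd : ∀ s t, S (s + t) = S s * C t + C s * S t :=
    cfc_sin_add Real.continuous_arccos a
  have hC1 : C 1 = a := by
    conv_rhs => rw [← cfc_id ℝ a]
    refine cfc_congr fun x hx => ?_
    have := abs_le.mp (hspec x hx)
    simp [Real.cos_arccos this.1 this.2]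
  have hCsa : ∀ t, IsSelfAdjoint (C t) := fun t => cfc_predicate _ a
  have hSsa : ∀ t, IsSelfAdjoint (S t) := fun t => cfc_predicate _ a
  have hS1 : S 1 * S 1 = b * b := by
    have h := hCadd 1 (-1)
    rw [add_neg_cancel, hC0, hCneg, hSneg, hC1, mul_neg, sub_neg_eq_add, ← hsq] at h
    exact (add_left_cancel h).symm
  have hCcomm : ∀ {q}, Commute a q → ∀ t, Commute (C t) q := fun h t => h.cfc_real _
  have hScomm : ∀ {q}, Commute a q → ∀ t, Commute (S t) q := fun h t => h.cfc_real _
  obtain ⟨f, hf⟩ := hker (S 1 - b)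
  have hfq : ∀ {q}, IsSelfAdjoint q → Commute a q → Commute b q → Commute f q :=
    fun hq h h' => hf.commute hq ((hScomm h 1).sub_left h')
  have hfb : (2 * f - 1) * S 1 = b := hf.reflection_mul (hSsa 1) hb (hScomm hac 1) hS1
  set e : A := 2 * f - 1 with he
  have heq : ∀ {q}, Commute f q → Commute e q := fun h =>
    ((Commute.ofNat_left 2 _).mul_left h).sub_left (Commute.one_left _)
  have hesa : IsSelfAdjoint e := by
    have : (2 : A) * f = f * 2 := (Commute.ofNat_left 2 f).eq
    simp [IsSelfAdjoint, he, hf.isSelfAdjoint.star_eq, this]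
  have hee : e * e = 1 := by
    have := hf.mul_self
    simp only [he, two_mul, sub_mul, mul_sub, add_mul, mul_add, this, one_mul, mul_one]
    abel
  have heC : ∀ t, Commute e (C t) := fun t =>
    heq (hfq (hCsa t) (hCcomm (.refl a) t).symm (hCcomm hac t).symm)
  have heS : ∀ t, Commute e (S t) := fun t =>
    heq (hfq (hSsa t) (hScomm (.refl a) t).symm (hScomm hac t).symm)
  refine ⟨fun t => C t + I • (e * S t), ?_, ?_, ?_, ?_, ?_, ?_, ?_⟩
  · exact (continuous_cfc_comp_mul Real.continuous_cos Real.continuous_arccos a).add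
      ((continuous_const.mul
        (continuous_cfc_comp_mul Real.continuous_sin Real.continuous_arccos a)).const_smul I)
  · simp [hC0, hS0]
  · intro s t
    have h1 : e * S s * (e * S t) = S s * S t := by
      rw [mul_assoc, ← mul_assoc (S s), ← (heS s).eq, mul_assoc, ← mul_assoc e e, hee, one_mul]
    have h2 : C s * (e * S t) = e * (C s * S t) := by
      rw [← mul_assoc, ← (heC s).eq, mul_assoc]
    simp only [hCadd, hSadd, add_mul, mul_add, smul_mul_assoc, mul_smul_comm, smul_add, smul_smul,
      h1, h2, mul_assoc e, I_mul_I, neg_smul, one_smul]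
    abel
  · simp only [hC1, hfb, hab]
  · intro t
    simp [hCneg, hSneg, (hCsa t).star_eq, (hSsa t).star_eq, hesa.star_eq, (heS t).eq]
  · intro q hq h t
    have h' : Commute (star m) q := by simpa [hq.star_eq] using h.star_star
    have haq : Commute a q := by
      rw [ha_def, realPart_apply_coe]
      exact (h.add_left h').smul_left _
    have hbq : Commute b q := by
      rw [hb_def, imaginaryPart_apply_coe]
      exact ((h.sub_left h').smul_left _).smul_left _
    exact (hCcomm haq t).add_left (((heq (hfq hq haq hbq)).mul_left (hScomm haq t)).smul_left I)
  · intro φ hφc hφφ hφI hφm t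
    have hφm' : φ (star m) = m := by rw [map_star, hφm, star_star]
    have hφa : φ a = a := by
      rw [ha_def, realPart_apply_coe, map_smul, map_add, hφm, hφm', add_comm]
    have hφb : φ b = b := by
      rw [hb_def, imaginaryPart_apply_coe, neg_smul, map_neg, hφI, map_smul, map_sub, hφm, hφm',
        ← neg_sub, smul_neg, smul_neg, neg_neg]
    have hφC : ∀ s, φ (C s) = C s := fun s =>
      map_cfc_of_map_eq hφc ha hφa (Real.continuous_cos.comp (Real.continuous_arccos.const_mul s))
    have hφS : ∀ s, φ (S s) = S s := fun s =>
      map_cfc_of_map_eq hφc ha hφa (Real.continuous_sin.comp (Real.continuous_arccos.const_mul s))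
    have hφe : φ e = e := by
      rw [he, map_sub, map_mul, hf.map_eq hφφ (by rw [map_sub, hφS, hφb]), map_one, map_ofNat]
    simp [hφC, hφS, hφe, hφI, hCneg, hSneg]

end OneParameterGroup

section Operator

variable {H : Type*} [NormedAddCommGroup H] [InnerProductSpace ℂ H]

lemma inner_map_map_of_antiunitary (T : H ≃ₛₗᵢ[starRingEnd ℂ] H) (x y : H) :
    inner ℂ (T x) (T y) = inner ℂ y x := by
  have h1 : T x - I • T y = T (x + I • y) := by
    rw [map_add, map_smulₛₗ, conj_I, neg_smul, sub_eq_add_neg]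
  have h2 : T x + I • T y = T (x - I • y) := by
    rw [map_sub, map_smulₛₗ, conj_I, neg_smul, sub_neg_eq_add]
  have h3 : y - I • x = (-I) • (x + I • y) := by
    rw [smul_add, smul_smul, neg_mul, I_mul_I, neg_neg, one_smul, neg_smul]
    abel
  have h4 : y + I • x = I • (x - I • y) := by
    rw [smul_sub, smul_smul, I_mul_I, neg_smul, one_smul]
    abel
  rw [inner_eq_sum_norm_sq_div_four, inner_eq_sum_norm_sq_div_four]
  simp only [RCLike.I_to_complex, ← map_add, ← map_sub, h1, h2, h3, h4, T.norm_map, norm_smul,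
    norm_neg, norm_I, one_mul, add_comm y x, norm_sub_rev y x]

variable [CompleteSpace H]

lemma exists_isKernelProjection (n : H →L[ℂ] H) : ∃ f, IsKernelProjection n f := by
  have : CompleteSpace n.ker := n.isClosed_ker.completeSpace_coe
  refine ⟨n.ker.starProjection, isSelfAdjoint_starProjection _, ?_, fun y hy => ?_⟩
  · ext x
    exact Submodule.starProjection_apply_mem n.ker x
  · ext x
    exact Submodule.starProjection_eq_self_iff.mpr congr($hy x)

/-- Conjugation of operators by an antiunitary operator. -/
def antiunitaryConj (T : H ≃ₛₗᵢ[starRingEnd ℂ] H) : (H →L[ℂ] H) →⋆ₐ[ℝ] (H →L[ℂ] H) where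
  toFun Y := (T : H →SL[starRingEnd ℂ] H).comp (Y.comp (T.symm : H →SL[starRingEnd ℂ] H))
  map_one' := by ext; simp
  map_mul' _ _ := by ext; simp
  map_zero' := by ext; simp
  map_add' _ _ := by ext; simp
  commutes' r := by
    ext x
    have : T ((r : ℂ) • T.symm x) = (r : ℂ) • x := by
      rw [map_smulₛₗ, conj_ofReal, T.apply_symm_apply]
    simpa [Algebra.algebraMap_eq_smul_one] using this
  map_star' Y := by
    refine (ContinuousLinearMap.eq_adjoint_iff _ _).mpr fun x y => ?_
    obtain ⟨x, rfl⟩ := T.surjective x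
    obtain ⟨y, rfl⟩ := T.surjective y
    simp [inner_map_map_of_antiunitary, ContinuousLinearMap.star_eq_adjoint,
      ContinuousLinearMap.adjoint_inner_right]

lemma antiunitaryConj_apply (T : H ≃ₛₗᵢ[starRingEnd ℂ] H) (Y : H →L[ℂ] H) (x : H) :
    antiunitaryConj T Y x = T (Y (T.symm x)) := rfl

lemma antiunitaryConj_eq_iff {T : H ≃ₛₗᵢ[starRingEnd ℂ] H} {Y Z : H →L[ℂ] H} :
    antiunitaryConj T Y = Z ↔ ∀ x, T (Y x) = Z (T x) := by
  rw [ContinuousLinearMap.ext_iff, T.surjective.forall]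
  simp [antiunitaryConj_apply]

lemma continuous_antiunitaryConj (T : H ≃ₛₗᵢ[starRingEnd ℂ] H) :
    Continuous (antiunitaryConj T) := by
  refine AddMonoidHomClass.continuous_of_bound (antiunitaryConj T) 1 fun Y => ?_
  refine ContinuousLinearMap.opNorm_le_bound _ (by positivity) fun x => ?_
  rw [antiunitaryConj_apply, T.norm_map, one_mul]
  simpa using Y.le_opNorm (T.symm x)

lemma antiunitaryConj_I_smul (T : H ≃ₛₗᵢ[starRingEnd ℂ] H) (Y : H →L[ℂ] H) :
    antiunitaryConj T (I • Y) = -(I • antiunitaryConj T Y) := by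
  ext x
  simp [antiunitaryConj_apply, map_smulₛₗ]

lemma antiunitaryConj_antiunitaryConj {T : H ≃ₛₗᵢ[starRingEnd ℂ] H} (hT : ∀ x, T (T x) = -x)
    (Y : H →L[ℂ] H) : antiunitaryConj T (antiunitaryConj T Y) = Y := by
  rw [antiunitaryConj_eq_iff]
  intro x
  rw [antiunitaryConj_apply, hT]
  obtain ⟨x, rfl⟩ := T.surjective x
  simp [hT, ← map_neg]

end Operator

/-- On a compact interval, a fixed number of elementary steps connects `P 0` to `P k`. -/
lemma exists_isUnit_stepIntertwiner {A : Type*} [CStarAlgebra A] {P : ℝ → A} (hc : Continuous P)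
    (hP : ∀ k, IsIdempotentElem (P k)) {r : ℝ} (hr : 0 < r) :
    ∃ N : ℕ, 0 < N ∧ ∀ k ∈ Set.Icc (-r) r, IsUnit (stepIntertwiner P (k / N) N) := by
  have hu := isCompact_Icc.uniformContinuousOn_of_continuous (hc.continuousOn (s := Set.Icc (-r) r))
  obtain ⟨δ, hδ, h⟩ := Metric.uniformContinuousOn_iff.mp hu 1 one_pos
  obtain ⟨N, hN⟩ := exists_nat_gt (r / δ)
  have hN0 : (0 : ℝ) < N := (by positivity : 0 < r / δ).trans hN
  refine ⟨N, by exact_mod_cast hN0, fun k hk => isUnit_stepIntertwiner hP _ _ fun j hj => ?_⟩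
  have hk' : |k| ≤ r := abs_le.mpr hk
  have hmem : ∀ i : ℕ, i ≤ N → (i : ℝ) * (k / N) ∈ Set.Icc (-r) r := fun i hi => by
    have hi' : (i : ℝ) / N ≤ 1 := (div_le_one hN0).mpr (by exact_mod_cast hi)
    rw [Set.mem_Icc, ← abs_le, mul_div_left_comm, abs_mul,
      abs_of_nonneg (by positivity : 0 ≤ (i : ℝ) / N)]
    nlinarith [abs_nonneg k]
  rw [← dist_eq_norm]
  refine h _ (hmem _ hj) _ (hmem _ hj.le) ?_
  rw [Real.dist_eq, ← sub_mul, Nat.cast_succ, add_sub_cancel_left, one_mul, abs_div, Nat.abs_cast,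
    div_lt_iff₀ hN0]
  rw [div_lt_iff₀ hδ] at hN
  linarith

lemma exists_periodic_extension {B : Type*} [TopologicalSpace B] {f : ℝ → B}
    (hf : ContinuousOn f (Set.Icc (-π) π)) (h : f (-π) = f π) :
    ∃ U : ℝ → B, Continuous U ∧ Function.Periodic U (2 * π) ∧ Set.EqOn U f (Set.Icc (-π) π) := by
  have : Fact (0 < 2 * π) := ⟨Real.two_pi_pos⟩
  have hp : -π + 2 * π = π := by ring
  have hf' : f (-π) = f (-π + 2 * π) := by rw [hp, h]
  refine ⟨fun k => AddCircle.liftIco (2 * π) (-π) f (k : AddCircle (2 * π)),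
    (AddCircle.liftIco_continuous hf' (by rwa [hp])).comp (AddCircle.continuous_mk' _),
    fun k => by simp only [AddCircle.coe_add_period], fun k hk => ?_⟩
  rcases hk.2.eq_or_lt with rfl | hlt
  · rw [← h, ← AddCircle.liftIco_coe_apply (p := 2 * π) (a := -π) (f := f) (x := -π)
      ⟨le_rfl, by linarith [Real.pi_pos]⟩, ← AddCircle.coe_add_period (2 * π) (-π), hp]
  · exact AddCircle.liftIco_coe_apply ⟨hk.1, by rwa [hp]⟩

/-- A continuous periodic family of projections in a `C⋆`-algebra with kernel projections admits a
continuous periodic unitary transport, which respects every time-reversal symmetry of the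
family. -/
theorem exists_periodic_transport {A : Type*} [CStarAlgebra A] [PartialOrder A] [StarOrderedRing A]
    (hker : ∀ n : A, ∃ f, IsKernelProjection n f) {P : ℝ → A}
    (hcont : Continuous P) (hper : ∀ k, P (k + 2 * π) = P k)
    (hsa : ∀ k, IsSelfAdjoint (P k)) (hidem : ∀ k, IsIdempotentElem (P k)) :
    ∃ U : ℝ → A, Continuous U ∧ (∀ k, U (k + 2 * π) = U k) ∧ (∀ k, U k ∈ unitary A) ∧
      (∀ k, P k = U k * P 0 * star (U k)) ∧
      ∀ φ : A →⋆ₐ[ℝ] A, Continuous φ → (∀ a, φ (φ a) = a) → (∀ a, φ (I • a) = -(I • φ a)) →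
        (∀ k, φ (P k) = P (-k)) → ∀ k, φ (U k) = U (-k) := by
  obtain ⟨N, hN, hunit⟩ := exists_isUnit_stepIntertwiner hcont hidem Real.pi_pos
  let W : ℝ → A := fun k => polarPart (stepIntertwiner P (k / N) N)
  have hNk : ∀ k : ℝ, N * (k / N) = k := fun k => mul_div_cancel₀ k (by positivity)
  have hWu : ∀ k ∈ Set.Icc (-π) π, W k ∈ unitary A := fun k hk => polarPart_mem_unitary (hunit k hk)
  have hWc : ContinuousOn W (Set.Icc (-π) π) := fun k hk =>
    (ContinuousAt.comp (f := fun k : ℝ => stepIntertwiner P (k / N) N)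
      (continuousAt_polarPart (hunit k hk))
      ((continuous_stepIntertwiner hcont N).comp
        (continuous_id.div_const _)).continuousAt).continuousWithinAt
  have hWP : ∀ k ∈ Set.Icc (-π) π, W k * P 0 = P k * W k := fun k hk => by
    refine polarPart_intertwines (hunit k hk) (hsa _) (hsa _) ?_
    rw [stepIntertwiner_mul hidem, hNk]
  have hWφ : ∀ φ : A →⋆ₐ[ℝ] A, (∀ k, φ (P k) = P (-k)) → ∀ k ∈ Set.Icc (-π) π,
      φ (W k) = W (-k) := fun φ hφ k hk => by
    rw [map_polarPart φ (hunit k hk), map_stepIntertwiner φ hφ, ← neg_div]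
  have hπ : π ∈ Set.Icc (-π) π := ⟨by linarith [Real.pi_pos], le_rfl⟩
  have hπ' : -π ∈ Set.Icc (-π) π := ⟨le_rfl, hπ.1⟩
  have hPπ : P (-π) = P π := by rw [← hper]; congr 1; ring
  have hWstar : ∀ k ∈ Set.Icc (-π) π, P 0 * star (W k) = star (W k) * P k := fun k hk => by
    simpa [(hsa _).star_eq] using congr(star $(hWP k hk))
  obtain ⟨V, hVc, hV0, hVadd, hV1, hVstar, hVcomm, hVφ⟩ :=
    exists_unitary_one_parameter_group hker
      (mul_mem (Unitary.star_mem (hWu _ hπ')) (hWu _ hπ))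
  have hVu : ∀ t, V t ∈ unitary A := fun t => by
    rw [Unitary.mem_iff, hVstar, ← hVadd, ← hVadd, neg_add_cancel, add_neg_cancel]
    exact ⟨hV0, hV0⟩
  have hVP : ∀ t, Commute (V t) (P 0) := hVcomm _ (hsa 0) <| by
    rw [Commute, SemiconjBy, mul_assoc, hWP _ hπ, ← mul_assoc, ← hPπ, ← hWstar _ hπ', mul_assoc]
  let f : ℝ → A := fun k => W k * V (-(k / (2 * π)))
  have hfc : ContinuousOn f (Set.Icc (-π) π) :=
    hWc.mul (hVc.comp (continuous_id.div_const _).neg).continuousOn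
  have hff : f (-π) = f π := by
    have h2 : -(-π / (2 * π)) = 1 + -(π / (2 * π)) := by field_simp; norm_num
    simp only [f]
    rw [h2, hVadd, hV1, ← mul_assoc, ← mul_assoc, (hWu _ hπ').2, one_mul]
  have hfu : ∀ k ∈ Set.Icc (-π) π, f k ∈ unitary A := fun k hk => mul_mem (hWu k hk) (hVu _)
  have hfP : ∀ k ∈ Set.Icc (-π) π, P k = f k * P 0 * star (f k) := fun k hk => by
    have h : f k * P 0 = P k * f k := by
      simp only [f]
      rw [mul_assoc, (hVP _).eq, ← mul_assoc, hWP k hk, mul_assoc]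
    rw [h, mul_assoc, (hfu k hk).2, mul_one]
  obtain ⟨U, hUc, hUper, hUf⟩ := exists_periodic_extension hfc hff
  have hrep : ∀ k : ℝ, ∃ x ∈ Set.Icc (-π) π, P k = P x ∧ U k = U x ∧ U (-k) = U (-x) := by
    intro k
    obtain ⟨n, hn, -⟩ := existsUnique_add_zsmul_mem_Ico Real.two_pi_pos k (-π)
    refine ⟨_, ⟨hn.1, by linarith [hn.2]⟩, (Function.Periodic.zsmul hper n k).symm,
      (hUper.zsmul n k).symm, ?_⟩
    rw [neg_add, ← sub_eq_add_neg, hUper.sub_zsmul_eq]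
  refine ⟨U, hUc, hUper, fun k => ?_, fun k => ?_, fun φ hφc hφφ hφI hφP k => ?_⟩ <;>
    obtain ⟨x, hx, hPx, hUx, hUx'⟩ := hrep k
  · rw [hUx, hUf hx]
    exact hfu x hx
  · rw [hPx, hUx, hUf hx]
    exact hfP x hx
  · have hVφ := hVφ φ hφc hφφ hφI (by
      rw [map_mul, map_star, hWφ φ hφP _ hπ', hWφ φ hφP _ hπ, star_mul, star_star, neg_neg])
    rw [hUx, hUx', hUf hx, hUf ⟨neg_le_neg hx.2, neg_le.mp hx.1⟩, map_mul, hWφ φ hφP x hx, hVφ]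
    simp only [f, neg_div]

/-- **Continuous parallel transport in one dimension (Kato–Nagy 1-d construction).**
Any continuous, `2π`-periodic, rank-`m` projection-valued map on the circle admits a
continuous periodic unitary transport intertwining `P 0` with `P k`; in the presence of a
fermionic time-reversal symmetry the transport can moreover be chosen symmetric. -/
theorem continuous_parallel_transport_one_dim
    {H : Type*} [NormedAddCommGroup H] [InnerProductSpace ℂ H] [CompleteSpace H]
    [TopologicalSpace.SeparableSpace H]
    (m : ℕ) (P : ℝ → H →L[ℂ] H)
    (hcont : Continuous P)
    (hper : ∀ k : ℝ, P (k + 2 * π) = P k)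
    (hsa : ∀ k, IsSelfAdjoint (P k))
    (hidem : ∀ k, IsIdempotentElem (P k))
    (hrank : ∀ k, Module.finrank ℂ (LinearMap.range (P k : H →ₗ[ℂ] H)) = m) :
    (∃ U : ℝ → H →L[ℂ] H,
      Continuous U ∧
      (∀ k : ℝ, U (k + 2 * π) = U k) ∧
      (∀ k, U k ∈ unitary (H →L[ℂ] H)) ∧
      (∀ k, P k = U k * P 0 * star (U k))) ∧
    (∀ T : H ≃ₛₗᵢ[starRingEnd ℂ] H, (∀ x, T (T x) = -x) →
      (∀ (k : ℝ) (x : H), T (P k x) = P (-k) (T x)) →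
      ∃ U : ℝ → H →L[ℂ] H,
        Continuous U ∧
        (∀ k : ℝ, U (k + 2 * π) = U k) ∧
        (∀ k, U k ∈ unitary (H →L[ℂ] H)) ∧
        (∀ k, P k = U k * P 0 * star (U k)) ∧
        (∀ (k : ℝ) (x : H), T (U k x) = U (-k) (T x))) := by
  obtain ⟨U, hUc, hUper, hUu, hUP, hUφ⟩ :=
    exists_periodic_transport exists_isKernelProjection hcont hper hsa hidem
  refine ⟨⟨U, hUc, hUper, hUu, hUP⟩, fun T hT hTP => ⟨U, hUc, hUper, hUu, hUP, fun k => ?_⟩⟩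
  exact antiunitaryConj_eq_iff.mp <| hUφ (antiunitaryConj T) (continuous_antiunitaryConj T)
    (antiunitaryConj_antiunitaryConj hT) (antiunitaryConj_I_smul T)
    (fun k => antiunitaryConj_eq_iff.mpr (hTP k)) k

end
end

section
/- Let n ≥ 1 and let J be the 2n×2n block matrix [[0, −I_n],[I_n, 0]]. If γ and γ′ are unitary 2n×2n complex matrices satisfying J γᵗ J⁻¹ γ = J (γ′)ᵗ J⁻¹ γ′, then det γ = det γ′. Consequently, for a unitary matrix α with α = J γᵗ J⁻¹ γ, the determinant det γ depends only on α and not on the choice of γ. -/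
noncomputable section

open Matrix in
/-- Congruence by `A` and by an invertible `B` carrying `J` to the same form forces
`det A = det B`, since `A * B⁻¹` is then symplectic. -/
theorem Matrix.det_eq_of_transpose_mul_J_mul_eq {l R : Type*} [DecidableEq l] [Fintype l]
    [CommRing R] {A B : Matrix (l ⊕ l) (l ⊕ l) R} (hB : IsUnit B.det)
    (h : Aᵀ * J l R * A = Bᵀ * J l R * B) : A.det = B.det := by
  have hmem : A * B⁻¹ ∈ symplecticGroup l R := by
    rw [SymplecticGroup.mem_iff']
    calc (A * B⁻¹)ᵀ * J l R * (A * B⁻¹) = (B⁻¹)ᵀ * (Aᵀ * J l R * A) * B⁻¹ := by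
          simp only [transpose_mul, Matrix.mul_assoc]
      _ = (B * B⁻¹)ᵀ * J l R * (B * B⁻¹) := by
          rw [h]; simp only [transpose_mul, Matrix.mul_assoc]
      _ = J l R := by simp [mul_nonsing_inv B hB]
  rw [← nonsing_inv_mul_cancel_right B A hB, det_mul, SymplecticGroup.det_eq_one hmem, one_mul]

/-- If two unitary `2n × 2n` matrices `γ`, `γ′` satisfy
`J γᵗ J⁻¹ γ = J (γ′)ᵗ J⁻¹ γ′`, where `J = [[0, −Iₙ],[Iₙ, 0]]`, then `det γ = det γ′`.
Hence for a unitary matrix `α` written as `α = J γᵗ J⁻¹ γ`, the determinant of `γ` depends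
only on `α`. -/
theorem det_unique_of_symplectic_square
    (n : ℕ) (hn : 1 ≤ n)
    (J : Matrix (Fin (2 * n)) (Fin (2 * n)) ℂ)
    (hJ : J = Matrix.reindex (finSumFinEquiv.trans (finCongr (two_mul n).symm))
        (finSumFinEquiv.trans (finCongr (two_mul n).symm))
        (Matrix.fromBlocks 0 (-1) 1 0))
    (γ γ' : Matrix (Fin (2 * n)) (Fin (2 * n)) ℂ)
    (hγ : γ ∈ Matrix.unitaryGroup (Fin (2 * n)) ℂ)
    (hγ' : γ' ∈ Matrix.unitaryGroup (Fin (2 * n)) ℂ)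
    (h : J * γ.transpose * J⁻¹ * γ = J * γ'.transpose * J⁻¹ * γ') :
    γ.det = γ'.det := by
  set e := finSumFinEquiv.trans (finCongr (two_mul n).symm)
  have hJ_inv : J⁻¹ = -J := by
    rw [hJ]
    change (Matrix.reindex e e (Matrix.J (Fin n) ℂ))⁻¹ = -Matrix.reindex e e (Matrix.J (Fin n) ℂ)
    rw [Matrix.inv_reindex, Matrix.J_inv]
    rfl
  have hJ_det : IsUnit J.det := by
    rw [hJ, Matrix.det_reindex_self]
    exact Matrix.isUnit_det_J (Fin n) ℂ
  have hform : γ.transpose * J * γ = γ'.transpose * J * γ' := by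
    have := congrArg (J⁻¹ * ·) h
    simp only [Matrix.mul_assoc, Matrix.nonsing_inv_mul_cancel_left J _ hJ_det] at this
    simpa only [Matrix.mul_assoc, hJ_inv, Matrix.neg_mul, Matrix.mul_neg, neg_inj] using this
  have hγ'_det : IsUnit (γ'.submatrix e e).det := by
    rw [Matrix.det_submatrix_equiv_self, ← Matrix.isUnit_iff_isUnit_det]
    exact Unitary.isUnit_coe (U := ⟨γ', hγ'⟩)
  have hJ_sub : J.submatrix e e = Matrix.J (Fin n) ℂ := by
    rw [hJ, Matrix.reindex_apply, Matrix.submatrix_submatrix, e.symm_comp_self,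
      Matrix.submatrix_id_id]
    rfl
  rw [← Matrix.det_submatrix_equiv_self e γ, ← Matrix.det_submatrix_equiv_self e γ']
  refine Matrix.det_eq_of_transpose_mul_J_mul_eq hγ'_det ?_
  simp only [← hJ_sub, Matrix.transpose_submatrix, Matrix.submatrix_mul_equiv, hform]

end
end
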